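/- arXiv:2409.04804 — 5 statements merged into one kernel-verified Lean document; each statement's English description precedes it below -/
import Mathlib

section
/- Let u be a solution of problem (1D) with u′(t) > 0 for all t > 0. Then the limit ρ := lim_{t→+∞} u(t) exists and is finite, f(ρ) = 0, F(t) < F(ρ) for all t ∈ (0, ρ), the identity ((p−1)/p)·|u′(t)|^p + F(u(t)) = F(ρ) holds for all t ≥ 0, and u′(0) = ((p/(p−1))·F(ρ))^{1/p}. If moreover f(0) ≥ 0, then F(ρ) > 0. -/
open Real Filter Set Topology MeasureTheory

/-- `Fint f t = ∫_0^t f(s) ds`. -/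
noncomputable def Fint (f : ℝ → ℝ) (t : ℝ) : ℝ := ∫ s in (0:ℝ)..t, f s

/-- The zero set of `f` in `[0,∞)`. -/
def Zf (f : ℝ → ℝ) : Set ℝ := {z : ℝ | 0 ≤ z ∧ f z = 0}

/-- `f` is locally Lipschitz on the set `s`. -/
def LocLipOn (f : ℝ → ℝ) (s : Set ℝ) : Prop :=
  ∀ x ∈ s, ∃ K : NNReal, ∃ t ∈ nhdsWithin x s, LipschitzOnWith K f t

/-- Condition (SMP): at every zero `z` of `f`,
`liminf_{t→z⁺} f(t)/(t−z)^{p−1} > −∞` and `limsup_{t→z⁻} f(t)/(z−t)^{p−1} < +∞`. -/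
def SMP (p : ℝ) (f : ℝ → ℝ) : Prop :=
  ∀ z ∈ Zf f,
    (⊥ : EReal) <
      Filter.liminf (fun t : ℝ => ((f t / (t - z) ^ (p - 1) : ℝ) : EReal))
        (nhdsWithin z (Set.Ioi z)) ∧
    Filter.limsup (fun t : ℝ => ((f t / (z - t) ^ (p - 1) : ℝ) : EReal))
      (nhdsWithin z (Set.Ico 0 z)) < (⊤ : EReal)

/-- A solution of problem (1D): a bounded nonnegative `C¹` function `u` on `[0,∞)`
with `u(0)=0`, derivative `u'`, such that `t ↦ |u'(t)|^{p−2} u'(t)` is differentiable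
on `(0,∞)` with derivative `−f(u(t))` there. -/
structure Sol1D (p : ℝ) (f : ℝ → ℝ) (u u' : ℝ → ℝ) : Prop where
  hasDeriv : ∀ t ∈ Set.Ici (0:ℝ), HasDerivWithinAt u (u' t) (Set.Ici (0:ℝ)) t
  derivCont : ContinuousOn u' (Set.Ici (0:ℝ))
  bounded : ∃ M : ℝ, ∀ t ∈ Set.Ici (0:ℝ), |u t| ≤ M
  zeroAtZero : u 0 = 0
  nonneg : ∀ t ∈ Set.Ici (0:ℝ), 0 ≤ u t
  ode : ∀ t ∈ Set.Ioi (0:ℝ),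
    HasDerivAt (fun s : ℝ => |u' s| ^ (p - 2) * u' s) (-(f (u t))) t

/-- If a function and its derivative both converge at infinity, the derivative tends to zero. -/
theorem deriv_limit_eq_zero_of_tendsto {h h' : ℝ → ℝ} {a b : ℝ}
    (hd : ∀ t > (0:ℝ), HasDerivAt h (h' t) t)
    (ha : Tendsto h atTop (𝓝 a)) (hb : Tendsto h' atTop (𝓝 b)) : b = 0 := by
  have key : ∀ t : ℝ, ∃ c, 0 < t → t < c ∧ h' c = h (t + 1) - h t := by
    intro t
    by_cases ht : 0 < t
    · obtain ⟨c, hc, hc'⟩ := exists_hasDerivAt_eq_slope h h' (lt_add_one t)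
        (fun x hx => (hd x (ht.trans_le hx.1)).continuousAt.continuousWithinAt)
        (fun x hx => hd x (ht.trans hx.1))
      exact ⟨c, fun _ => ⟨hc.1, by rw [hc']; simp⟩⟩
    · exact ⟨0, fun h => absurd h ht⟩
  choose c hc using key
  have hct : Tendsto c atTop atTop :=
    tendsto_atTop_mono' _ ((eventually_gt_atTop 0).mono fun t ht => (hc t ht).1.le) tendsto_id
  have h1 : Tendsto (fun t => h (t + 1) - h t) atTop (𝓝 (a - a)) :=
    (ha.comp (tendsto_atTop_add_const_right _ 1 tendsto_id)).sub ha
  have h2 : Tendsto (fun t => h (t + 1) - h t) atTop (𝓝 b) :=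
    (hb.comp hct).congr' ((eventually_gt_atTop 0).mono fun t ht => (hc t ht).2)
  simpa using tendsto_nhds_unique h2 h1

/-- Extending `f` by its value at `0` gives a differentiable primitive agreeing with `Fint f`. -/
theorem exists_primitive_eq_Fint {f : ℝ → ℝ} (hfc : ContinuousOn f (Ici 0)) :
    ∃ G : ℝ → ℝ, (∀ x ≥ 0, Fint f x = G x) ∧ (∀ x ≥ 0, HasDerivAt G (f x) x) ∧ G 0 = 0 ∧
      Continuous G := by
  have hg : Continuous fun x : ℝ => f (max 0 x) :=
    hfc.comp_continuous (by fun_prop) fun x => le_max_left 0 x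
  have hd : ∀ x, HasDerivAt (fun x => ∫ s in (0:ℝ)..x, f (max 0 s)) (f (max 0 x)) x := fun x =>
    intervalIntegral.integral_hasDerivAt_right (hg.intervalIntegrable _ _)
      hg.stronglyMeasurable.stronglyMeasurableAtFilter hg.continuousAt
  refine ⟨fun x => ∫ s in (0:ℝ)..x, f (max 0 s), fun x hx => ?_, fun x hx => ?_, by simp,
    continuous_iff_continuousAt.2 fun x => (hd x).continuousAt⟩
  · refine intervalIntegral.integral_congr fun s hs => ?_
    rw [uIcc_of_le hx] at hs
    simp [max_eq_right hs.1]
  · simpa [max_eq_right hx] using hd x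

/-- The one-sided condition at `0` yields a power lower bound, also when `f 0 > 0`. -/
theorem exists_rpow_lower_bound {p : ℝ} {f : ℝ → ℝ} (hfc : ContinuousOn f (Ici 0))
    (hsmp : SMP p f) (h0 : 0 ≤ f 0) :
    ∃ C ≥ (0:ℝ), ∃ δ > (0:ℝ), ∀ t ∈ Ioo 0 δ, -(C * t ^ (p - 1)) ≤ f t := by
  have key : ∃ C ≥ (0:ℝ), ∀ᶠ t in 𝓝[>] (0:ℝ), -(C * t ^ (p - 1)) ≤ f t := by
    rcases h0.eq_or_lt with h0 | h0
    · obtain ⟨c, -, hc⟩ := EReal.lt_iff_exists_real_btwn.1 (hsmp 0 ⟨le_rfl, h0.symm⟩).1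
      refine ⟨|c|, abs_nonneg c, ?_⟩
      filter_upwards [eventually_lt_of_lt_liminf hc, self_mem_nhdsWithin] with t ht htpos
      have hpow : 0 < t ^ (p - 1) := rpow_pos_of_pos htpos _
      rw [EReal.coe_lt_coe_iff, sub_zero, lt_div_iff₀ hpow] at ht
      nlinarith [neg_abs_le c]
    · refine ⟨0, le_rfl, ?_⟩
      have hcont : Tendsto f (𝓝[>] 0) (𝓝 (f 0)) :=
        (hfc 0 self_mem_Ici).mono_left (nhdsWithin_mono _ Ioi_subset_Ici_self)
      filter_upwards [hcont.eventually_const_lt h0] with t ht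
      simpa using ht.le
  obtain ⟨C, hC, h⟩ := key
  obtain ⟨δ, hδ, h⟩ := mem_nhdsGT_iff_exists_Ioo_subset.1 h
  exact ⟨C, hC, δ, hδ, h⟩

/-- A primitive of a function bounded below by `-C t ^ (p - 1)` is bounded below by
`-(C / p) t ^ p`. -/
theorem primitive_lower_bound {p C δ : ℝ} (hp : 1 < p) {f G : ℝ → ℝ}
    (hG : ∀ x ≥ 0, HasDerivAt G (f x) x) (hG0 : G 0 = 0)
    (hf : ∀ t ∈ Ioo 0 δ, -(C * t ^ (p - 1)) ≤ f t) {x : ℝ} (hx : x ∈ Ioo 0 δ) :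
    -(C / p * x ^ p) ≤ G x := by
  have hp0 : p ≠ 0 := by linarith
  have hd : ∀ t ≥ 0, HasDerivAt (fun t => G t + C / p * t ^ p) (f t + C * t ^ (p - 1)) t := by
    intro t ht
    refine ((hG t ht).add ((hasDerivAt_rpow_const (Or.inr hp.le)).const_mul (C / p))).congr_deriv ?_
    field_simp
  have hmon : MonotoneOn (fun t => G t + C / p * t ^ p) (Icc 0 x) := by
    refine monotoneOn_of_hasDerivWithinAt_nonneg (convex_Icc 0 x)
      (fun t ht => (hd t ht.1).continuousAt.continuousWithinAt)
      (f' := fun t => f t + C * t ^ (p - 1)) (fun t ht => ?_) (fun t ht => ?_)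
    · rw [interior_Icc] at ht
      exact (hd t ht.1.le).hasDerivWithinAt
    · rw [interior_Icc] at ht
      linarith [hf t ⟨ht.1, ht.2.trans hx.2⟩]
  have := hmon (left_mem_Icc.2 hx.1.le) (right_mem_Icc.2 hx.1.le) hx.1.le
  simp only [hG0, zero_rpow hp0] at this
  linarith

/-- A differential inequality `v' ≤ K v` on `(0, s)` with `v 0 = 0` forces `v s ≤ 0`. -/
theorem nonpos_of_deriv_le_mul {v v' : ℝ → ℝ} {K s : ℝ} (hs : 0 < s)
    (hc : ContinuousOn v (Icc 0 s)) (hd : ∀ t ∈ Ioo 0 s, HasDerivAt v (v' t) t)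
    (hv : v 0 = 0) (hle : ∀ t ∈ Ioo 0 s, v' t ≤ K * v t) : v s ≤ 0 := by
  have hmon : AntitoneOn (fun t => v t * exp (-(K * t))) (Icc 0 s) := by
    refine antitoneOn_of_hasDerivWithinAt_nonpos (convex_Icc 0 s) (by fun_prop)
      (f' := fun t => (v' t - K * v t) * exp (-(K * t))) (fun t ht => ?_) (fun t ht => ?_)
    · rw [interior_Icc] at ht
      refine HasDerivAt.hasDerivWithinAt
        (((hd t ht).mul ((hasDerivAt_id t).const_mul K).neg.exp).congr_deriv ?_)
      simp only [id, Pi.neg_apply]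
      ring
    · rw [interior_Icc] at ht
      exact mul_nonpos_of_nonpos_of_nonneg (by linarith [hle t ht]) (exp_pos _).le
  have := hmon (left_mem_Icc.2 hs.le) (right_mem_Icc.2 hs.le) hs.le
  simp only [hv, zero_mul] at this
  exact nonpos_of_mul_nonpos_left this (exp_pos _)

theorem abs_rpow_sub_two_mul {x : ℝ} (hx : 0 < x) (p : ℝ) :
    |x| ^ (p - 2) * x = x ^ (p - 1) := by
  rw [abs_of_pos hx, ← rpow_add_one hx.ne']
  congr 1
  ring

/-- Conservation of energy along an increasing solution. -/
theorem Sol1D.exists_energy {p : ℝ} (hp : 1 < p) {f u u' G : ℝ → ℝ} (hu : Sol1D p f u u')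
    (hmono : ∀ t > (0:ℝ), 0 < u' t) (hG : ∀ x ≥ 0, HasDerivAt G (f x) x) :
    ∃ E, ∀ t ≥ 0, (p - 1) / p * |u' t| ^ p + G (u t) = E := by
  have hp1 : p - 1 ≠ 0 := by linarith
  have hp0 : p ≠ 0 := by linarith
  have hud : ∀ t > (0:ℝ), HasDerivAt u (u' t) t := fun t ht =>
    (hu.hasDeriv t ht.le).hasDerivAt (Ici_mem_nhds ht)
  have huc : ContinuousOn u (Ici 0) := fun t ht => (hu.hasDeriv t ht).continuousWithinAt
  have hpow : ∀ x > (0:ℝ), (|x| ^ (p - 2) * x) ^ (p / (p - 1)) = |x| ^ p := by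
    intro x hx
    rw [abs_rpow_sub_two_mul hx, ← rpow_mul hx.le, abs_of_pos hx]
    congr 1
    field_simp
  have hd : ∀ t > (0:ℝ), HasDerivAt (fun t => (p - 1) / p * |u' t| ^ p + G (u t)) 0 t := by
    intro t ht
    have hw : 0 < |u' t| ^ (p - 2) * u' t := by
      rw [abs_rpow_sub_two_mul (hmono t ht)]
      exact rpow_pos_of_pos (hmono t ht) _
    have h1 := (((hu.ode t ht).rpow_const (p := p / (p - 1)) (Or.inl hw.ne')).const_mul
      ((p - 1) / p)).add ((hG (u t) (hu.nonneg t ht.le)).comp t (hud t ht))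
    refine (h1.congr_of_eventuallyEq ?_).congr_deriv ?_
    · filter_upwards [Ioi_mem_nhds ht] with s hs
      simp [hpow (u' s) (hmono s hs)]
    · have h2 : (|u' t| ^ (p - 2) * u' t) ^ (p / (p - 1) - 1) = u' t := by
        rw [abs_rpow_sub_two_mul (hmono t ht), ← rpow_mul (hmono t ht).le]
        conv_rhs => rw [← rpow_one (u' t)]
        congr 1
        field_simp
        ring
      rw [h2]
      field_simp
      ring
  have hGc : ContinuousOn G (Ici 0) := fun x hx => (hG x hx).continuousAt.continuousWithinAt
  have hcont : ContinuousOn (fun t => (p - 1) / p * |u' t| ^ p + G (u t)) (Ici 0) :=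
    (continuousOn_const.mul (hu.derivCont.abs.rpow_const fun x _ => Or.inr (by linarith))).add
      (hGc.comp huc hu.nonneg)
  refine ⟨(p - 1) / p * |u' 0| ^ p + G (u 0), fun t ht => ?_⟩
  rcases ht.eq_or_lt with rfl | ht
  · rfl
  · obtain ⟨c, -, hc⟩ := exists_hasDerivAt_eq_slope _ (fun _ => (0:ℝ)) ht
      (hcont.mono Icc_subset_Ici_self) fun x hx => hd x hx.1
    rw [eq_comm, div_eq_zero_iff] at hc
    rcases hc with hc | hc <;> linarith

theorem stmt9 (p : ℝ) (hp : 1 < p) (f : ℝ → ℝ)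
    (hfc : ContinuousOn f (Set.Ici 0))
    (hflip : LocLipOn f (Set.Ici 0 \ Zf f))
    (hsmp : SMP p f)
    (u u' : ℝ → ℝ) (hu : Sol1D p f u u')
    (hmono : ∀ t > (0:ℝ), 0 < u' t) :
    ∃ ρ : ℝ, Filter.Tendsto u Filter.atTop (nhds ρ) ∧ f ρ = 0 ∧
      (∀ t ∈ Set.Ioo 0 ρ, Fint f t < Fint f ρ) ∧
      (∀ t ∈ Set.Ici (0:ℝ),
        (p - 1) / p * |u' t| ^ p + Fint f (u t) = Fint f ρ) ∧
      u' 0 = (p / (p - 1) * Fint f ρ) ^ (1/p) ∧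
      (0 ≤ f 0 → 0 < Fint f ρ) := by
  have hp0 : (0:ℝ) < p := by linarith
  have hp1 : (0:ℝ) < p - 1 := by linarith
  obtain ⟨G, hFG, hG, hG0, hGc⟩ := exists_primitive_eq_Fint hfc
  obtain ⟨E, hE⟩ := hu.exists_energy hp hmono hG
  have hud : ∀ t > (0:ℝ), HasDerivAt u (u' t) t := fun t ht =>
    (hu.hasDeriv t ht.le).hasDerivAt (Ici_mem_nhds ht)
  have huc : ContinuousOn u (Ici 0) := fun t ht => (hu.hasDeriv t ht).continuousWithinAt
  have hum : StrictMonoOn u (Ici 0) := by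
    refine strictMonoOn_of_hasDerivWithinAt_pos (convex_Ici 0) huc (f' := u')
      (fun t ht => ?_) (fun t ht => ?_)
    · rw [interior_Ici] at ht
      exact (hud t ht).hasDerivWithinAt
    · rw [interior_Ici] at ht
      exact hmono t ht
  have hupos : ∀ t > (0:ℝ), 0 < u t := fun t ht => by
    simpa [hu.zeroAtZero] using hum self_mem_Ici (mem_Ici.2 ht.le) ht
  obtain ⟨ρ, hρ⟩ : ∃ ρ, Tendsto u atTop (𝓝 ρ) := by
    obtain ⟨M, hM⟩ := hu.bounded
    have hmon : Monotone fun t => u (max 0 t) := fun a b hab =>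
      hum.monotoneOn (le_max_left 0 a) (le_max_left 0 b) (max_le_max_left 0 hab)
    have hbdd : BddAbove (range fun t => u (max 0 t)) := by
      refine ⟨M, ?_⟩
      rintro _ ⟨t, rfl⟩
      exact (le_abs_self _).trans (hM _ (le_max_left 0 t))
    refine ⟨_, (tendsto_atTop_ciSup hmon hbdd).congr' ?_⟩
    filter_upwards [eventually_ge_atTop 0] with t ht
    simp [max_eq_right ht]
  have hρ0 : 0 ≤ ρ := ge_of_tendsto hρ ((eventually_ge_atTop 0).mono fun t ht => hu.nonneg t ht)
  have hpow : ∀ t ≥ 0, |u' t| ^ p = p / (p - 1) * (E - G (u t)) := fun t ht => by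
    rw [← hE t ht]
    field_simp
    ring
  have hroot : ∀ t ≥ 0, |u' t| = (p / (p - 1) * (E - G (u t))) ^ (1 / p) := fun t ht => by
    rw [← hpow t ht, one_div, rpow_rpow_inv (abs_nonneg _) hp0.ne']
  have hGu : Tendsto (fun t => p / (p - 1) * (E - G (u t))) atTop
      (𝓝 (p / (p - 1) * (E - G ρ))) :=
    ((hGc.continuousAt.tendsto.comp hρ).const_sub E).const_mul _
  have hu'L : Tendsto u' atTop (𝓝 ((p / (p - 1) * (E - G ρ)) ^ (1 / p))) := by
    refine (hGu.rpow_const (Or.inr (by positivity))).congr' ?_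
    filter_upwards [eventually_gt_atTop 0] with t ht
    rw [← hroot t ht.le, abs_of_pos (hmono t ht)]
  have hL := deriv_limit_eq_zero_of_tendsto hud hρ hu'L
  rw [hL] at hu'L
  have hEρ : E = G ρ := by
    have h1 : Tendsto (fun t => |u' t| ^ p) atTop (𝓝 0) := by
      simpa [zero_rpow hp0.ne'] using hu'L.abs.rpow_const (p := p) (Or.inr hp0.le)
    have h2 := tendsto_nhds_unique h1 (hGu.congr' ((eventually_ge_atTop 0).mono
      fun t ht => (hpow t ht).symm))
    rcases mul_eq_zero.1 h2.symm with h | h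
    · exact absurd h (by positivity)
    · linarith
  have hfρ : f ρ = 0 := by
    have hw : Tendsto (fun t => |u' t| ^ (p - 2) * u' t) atTop (𝓝 0) := by
      have h1 : Tendsto (fun t => u' t ^ (p - 1)) atTop (𝓝 0) := by
        simpa [zero_rpow hp1.ne'] using hu'L.rpow_const (p := p - 1) (Or.inr hp1.le)
      exact h1.congr' ((eventually_gt_atTop 0).mono fun t ht =>
        (abs_rpow_sub_two_mul (hmono t ht) p).symm)
    have hfu : Tendsto (fun t => -(f (u t))) atTop (𝓝 (-(f ρ))) :=
      ((hfc ρ hρ0).tendsto.comp (tendsto_nhdsWithin_iff.2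
        ⟨hρ, (eventually_ge_atTop 0).mono fun t ht => hu.nonneg t ht⟩)).neg
    exact neg_eq_zero.1 (deriv_limit_eq_zero_of_tendsto hu.ode hw hfu)
  have hu'0 : 0 ≤ u' 0 := by
    have h1 : Tendsto u' (𝓝[>] 0) (𝓝 (u' 0)) :=
      (hu.derivCont 0 self_mem_Ici).mono_left (nhdsWithin_mono _ Ioi_subset_Ici_self)
    exact ge_of_tendsto h1 (eventually_mem_nhdsWithin.mono fun t ht => (hmono t ht).le)
  have hGpos : ∀ t > 0, G (u t) < G ρ := fun t ht => by
    have h1 : 0 < (p - 1) / p * |u' t| ^ p :=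
      mul_pos (by positivity) (rpow_pos_of_pos (abs_pos.2 (hmono t ht).ne') _)
    linarith [hE t ht.le]
  refine ⟨ρ, hρ, hfρ, fun t ht => ?_, fun t ht => ?_, ?_, fun h0 => ?_⟩
  · rw [hFG t ht.1.le, hFG ρ hρ0]
    obtain ⟨b, hb, hb0⟩ :=
      ((hρ.eventually_const_lt ht.2).and (eventually_gt_atTop 0)).exists
    obtain ⟨s, hs, rfl⟩ := intermediate_value_Ioo hb0.le (huc.mono Icc_subset_Ici_self)
      ⟨by simpa [hu.zeroAtZero] using ht.1, hb⟩
    exact hGpos s hs.1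
  · rw [hFG _ (hu.nonneg t ht), hFG ρ hρ0, hE t ht, hEρ]
  · have := hroot 0 le_rfl
    rwa [abs_of_nonneg hu'0, hu.zeroAtZero, hG0, sub_zero, hEρ, ← hFG ρ hρ0] at this
  · rw [hFG ρ hρ0]
    by_contra! hneg
    obtain ⟨C, hC, δ, hδ, hf⟩ := exists_rpow_lower_bound hfc hsmp h0
    obtain ⟨s, hsδ, hs⟩ : ∃ s > (0:ℝ), u s < δ := by
      have h1 : Tendsto u (𝓝[>] 0) (𝓝 (u 0)) :=
        (huc 0 self_mem_Ici).mono_left (nhdsWithin_mono _ Ioi_subset_Ici_self)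
      rw [hu.zeroAtZero] at h1
      exact (eventually_mem_nhdsWithin.and (h1.eventually_lt_const hδ)).exists
    refine (hupos s hsδ).not_ge (nonpos_of_deriv_le_mul
      (K := (p / (p - 1) * (C / p)) ^ (1 / p)) hsδ
      (huc.mono Icc_subset_Ici_self) (fun t ht => hud t ht.1) hu.zeroAtZero fun t ht => ?_)
    have hut := hupos t ht.1
    have hlow := primitive_lower_bound hp hG hG0 hf
      ⟨hut, (hum (mem_Ici.2 ht.1.le) (mem_Ici.2 hsδ.le) ht.2).trans hs⟩
    have hnonneg : 0 ≤ p / (p - 1) * (E - G (u t)) := by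
      rw [← hpow t ht.1.le]
      positivity
    calc u' t = (p / (p - 1) * (E - G (u t))) ^ (1 / p) := by
          rw [← hroot t ht.1.le, abs_of_pos (hmono t ht.1)]
      _ ≤ (p / (p - 1) * (C / p) * u t ^ p) ^ (1 / p) := by
          refine rpow_le_rpow hnonneg ?_ (by positivity)
          rw [mul_assoc]
          exact mul_le_mul_of_nonneg_left (by linarith) (by positivity)
      _ = (p / (p - 1) * (C / p)) ^ (1 / p) * u t := by
          rw [mul_rpow (by positivity) (by positivity), ← rpow_mul hut.le,
            mul_one_div_cancel hp0.ne', rpow_one]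
end

section
/- Let u be a solution of problem (1D). If there exists t1 ∈ (0, +∞) such that u′(t) > 0 for all t ∈ (0, t1) and u′(t1) = 0, then u′(0) = 0. -/
open Real Filter Set Topology MeasureTheory

/-- If `w = |x|^(p-2) x` along a curve `x` has derivative `w'`, then `|x|^p` has derivative
`p / (p - 1) * (x * w')`. -/
lemma hasDerivAt_abs_rpow_of_flux {p : ℝ} (hp : 1 < p) {x : ℝ → ℝ} {w' t : ℝ}
    (h : HasDerivAt (fun s : ℝ => |x s| ^ (p - 2) * x s) w' t) :
    HasDerivAt (fun s : ℝ => |x s| ^ p) (p / (p - 1) * (x t * w')) t := by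
  have hp1 : 0 < p - 1 := by linarith
  have hq : 1 < p / (p - 1) := by rw [lt_div_iff₀ hp1]; linarith
  have habs : ∀ y : ℝ, y ≠ 0 → |(|y| ^ (p - 2) * y)| = |y| ^ (p - 1) := by
    intro y hy
    have hy' : 0 < |y| := abs_pos.mpr hy
    rw [abs_mul, abs_of_nonneg (Real.rpow_nonneg hy'.le _), show p - 1 = (p - 2) + 1 by ring,
      Real.rpow_add_one hy'.ne']
  have h1 := (hasDerivAt_abs_rpow (|x t| ^ (p - 2) * x t) hq).comp t h
  have hfun : ((fun y : ℝ => |y| ^ (p / (p - 1))) ∘ fun s : ℝ => |x s| ^ (p - 2) * x s)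
      = fun s : ℝ => |x s| ^ p := by
    funext s
    rcases eq_or_ne (x s) 0 with hs | hs
    · simp [hs, Real.zero_rpow (by linarith : p / (p - 1) ≠ 0),
        Real.zero_rpow (by linarith : p ≠ 0)]
    · simp only [Function.comp_apply]
      rw [habs _ hs, ← Real.rpow_mul (abs_nonneg _), mul_div_cancel₀ _ hp1.ne']
  rw [hfun] at h1
  refine h1.congr_deriv ?_
  rcases eq_or_ne (x t) 0 with hs | hs
  · simp [hs]
  · have hy' : 0 < |x t| := abs_pos.mpr hs
    have key : |x t| ^ ((p - 1) * (p / (p - 1) - 2)) * |x t| ^ (p - 2) = 1 := by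
      rw [← Real.rpow_add hy']
      have : (p - 1) * (p / (p - 1) - 2) + (p - 2) = 0 := by field_simp; ring
      rw [this, Real.rpow_zero]
    rw [habs _ hs, ← Real.rpow_mul (abs_nonneg _)]
    linear_combination (p / (p - 1) * x t * w') * key

lemma Sol1D.continuousOn {p : ℝ} {f u u' : ℝ → ℝ} (hu : Sol1D p f u u') :
    ContinuousOn u (Ici 0) := fun t ht => (hu.hasDeriv t ht).continuousWithinAt

lemma Sol1D.hasDerivAt {p : ℝ} {f u u' : ℝ → ℝ} (hu : Sol1D p f u u') {t : ℝ} (ht : 0 < t) :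
    HasDerivAt u (u' t) t :=
  (hu.hasDeriv t ht.le).hasDerivAt (Ici_mem_nhds ht)

/-- Conservation of energy: `(p - 1) / p * |u'|^p + G(u)` is constant, where `G` is a primitive of
an extension `g` of the nonlinearity `f`. -/
lemma Sol1D.energy_eq {p : ℝ} (hp : 1 < p) {f g G u u' : ℝ → ℝ} (hu : Sol1D p f u u')
    (hgf : ∀ s, 0 ≤ s → g s = f s) (hG : ∀ s, HasDerivAt G (g s) s)
    {a b : ℝ} (ha : 0 ≤ a) (hb : 0 ≤ b) :
    (p - 1) / p * |u' a| ^ p + G (u a) = (p - 1) / p * |u' b| ^ p + G (u b) := by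
  have hp0 : 0 < p := by linarith
  have hp1 : 0 < p - 1 := by linarith
  have hGc : Continuous G := continuous_iff_continuousAt.mpr fun s => (hG s).continuousAt
  set E : ℝ → ℝ := fun t => (p - 1) / p * |u' t| ^ p + G (u t)
  have hEc : ContinuousOn E (Ici 0) :=
    (continuousOn_const.mul (hu.derivCont.abs.rpow_const fun _ _ => Or.inr hp0.le)).add
      (hGc.comp_continuousOn hu.continuousOn)
  have hEd : ∀ t ∈ interior (Ici (0 : ℝ)), HasDerivWithinAt E 0 (interior (Ici (0 : ℝ))) t := by
    intro t ht
    rw [interior_Ici] at ht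
    have h := ((hasDerivAt_abs_rpow_of_flux hp (hu.ode t ht)).const_mul ((p - 1) / p)).add
      ((hG (u t)).comp t (hu.hasDerivAt ht))
    refine HasDerivAt.hasDerivWithinAt ?_
    refine h.congr_deriv ?_
    rw [hgf _ (hu.nonneg t (Ioi_subset_Ici_self ht))]
    field_simp
    ring
  have hmono : MonotoneOn E (Ici 0) :=
    monotoneOn_of_hasDerivWithinAt_nonneg (convex_Ici 0) hEc hEd fun _ _ => le_rfl
  have hanti : AntitoneOn E (Ici 0) :=
    antitoneOn_of_hasDerivWithinAt_nonpos (convex_Ici 0) hEc hEd fun _ _ => le_rfl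
  rcases le_total a b with hab | hab
  · exact le_antisymm (hmono ha hb hab) (hanti ha hb hab)
  · exact le_antisymm (hanti hb ha hab) (hmono hb ha hab)

/-- The part of (SMP) to the left of a positive zero, as a one-sided bound. -/
lemma SMP.exists_left_bound {p : ℝ} {f : ℝ → ℝ} (h : SMP p f) {m : ℝ} (hm : 0 < m)
    (hfm : f m = 0) :
    ∃ C > 0, ∃ δ ∈ Ico 0 m, ∀ s ∈ Ioo δ m, f s ≤ C * (m - s) ^ (p - 1) := by
  obtain ⟨C, hC, -⟩ := EReal.lt_iff_exists_real_btwn.mp (h m ⟨hm.le, hfm⟩).2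
  have hev := Filter.eventually_lt_of_limsup_lt hC
  rw [nhdsWithin_Ico_eq_nhdsLT hm] at hev
  obtain ⟨δ, hδ, hsub⟩ := (mem_nhdsLT_iff_exists_mem_Ico_Ioo_subset hm).mp hev
  refine ⟨max C 1, by positivity, δ, hδ, fun s hs => ?_⟩
  have hlt : f s / (m - s) ^ (p - 1) < C := EReal.coe_lt_coe_iff.mp (hsub hs)
  have hpos : 0 < (m - s) ^ (p - 1) := Real.rpow_pos_of_pos (sub_pos.mpr hs.2) _
  rw [div_lt_iff₀ hpos] at hlt
  exact hlt.le.trans (mul_le_mul_of_nonneg_right (le_max_left _ _) hpos.le)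

/-- A one-sided bound `g ≤ C (m - s)^(p-1)` to the left of `m` integrates to a bound on the
increment of a primitive `G` of `g`. -/
lemma sub_le_of_deriv_le_rpow {p C δ m : ℝ} (hp : 1 < p) {g G : ℝ → ℝ}
    (hG : ∀ s, HasDerivAt G (g s) s) (hg : ∀ s ∈ Ioo δ m, g s ≤ C * (m - s) ^ (p - 1))
    {s : ℝ} (hs : s ∈ Icc δ m) : G m - G s ≤ C / p * (m - s) ^ p := by
  have hp0 : 0 < p := by linarith
  have hH : ∀ r, HasDerivAt (fun r => G r + C / p * (m - r) ^ p)
      (g r - C * (m - r) ^ (p - 1)) r := by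
    intro r
    have h := (((hasDerivAt_id r).const_sub m).rpow_const (p := p) (Or.inr hp.le)).const_mul (C / p)
    refine ((hG r).add h).congr_deriv ?_
    simp only [id]
    field_simp
    ring
  have hanti : AntitoneOn (fun r => G r + C / p * (m - r) ^ p) (Icc δ m) := by
    refine antitoneOn_of_hasDerivWithinAt_nonpos (convex_Icc δ m)
      (fun r _ => (hH r).continuousAt.continuousWithinAt)
      (fun r _ => (hH r).hasDerivWithinAt) fun r hr => ?_
    rw [interior_Icc] at hr
    linarith [hg r hr]
  have h := hanti hs (right_mem_Icc.mpr (hs.1.trans hs.2)) hs.2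
  simp only [sub_self, Real.zero_rpow hp0.ne', mul_zero, add_zero] at h
  linarith

/-- A function with `v' ≥ -K v` that starts positive stays positive. -/
lemma pos_of_deriv_ge_neg_mul {v v' : ℝ → ℝ} {a b K : ℝ} (hab : a ≤ b)
    (hc : ContinuousOn v (Icc a b)) (hd : ∀ t ∈ Ioo a b, HasDerivAt v (v' t) t)
    (h : ∀ t ∈ Ioo a b, -K * v t ≤ v' t) (ha : 0 < v a) : 0 < v b := by
  have he : ∀ t, HasDerivAt (fun t => Real.exp (K * t)) (Real.exp (K * t) * (K * 1)) t :=
    fun t => ((hasDerivAt_id t).const_mul K).exp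
  have hmono : MonotoneOn (fun t => v t * Real.exp (K * t)) (Icc a b) := by
    refine monotoneOn_of_hasDerivWithinAt_nonneg (convex_Icc a b)
      (f' := fun t => v' t * Real.exp (K * t) + v t * (Real.exp (K * t) * (K * 1)))
      (hc.mul (by fun_prop)) (fun t ht => ?_) fun t ht => ?_
    · rw [interior_Icc] at ht
      exact ((hd t ht).mul (he t)).hasDerivWithinAt
    · rw [interior_Icc] at ht
      have := mul_nonneg (sub_nonneg.mpr (h t ht)) (Real.exp_pos (K * t)).le
      linarith
  have h1 := hmono (left_mem_Icc.mpr hab) (right_mem_Icc.mpr hab) hab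
  have h2 : 0 < v a * Real.exp (K * a) := mul_pos ha (Real.exp_pos _)
  exact pos_of_mul_pos_left (h2.trans_le h1) (Real.exp_pos _).le

lemma Sol1D.strictMonoOn {p : ℝ} {f u u' : ℝ → ℝ} (hu : Sol1D p f u u') {t1 : ℝ}
    (hpos : ∀ t ∈ Ioo 0 t1, 0 < u' t) : StrictMonoOn u (Icc 0 t1) := by
  refine strictMonoOn_of_hasDerivWithinAt_pos (convex_Icc 0 t1) (f' := u')
    (hu.continuousOn.mono Icc_subset_Ici_self) (fun t ht => ?_) fun t ht => ?_
  · rw [interior_Icc] at ht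
    exact (hu.hasDerivAt ht.1).hasDerivWithinAt
  · rw [interior_Icc] at ht
    exact hpos t ht

lemma Sol1D.strictAntiOn {p : ℝ} {f u u' : ℝ → ℝ} (hu : Sol1D p f u u') {a b : ℝ} (ha : 0 ≤ a)
    (hneg : ∀ t ∈ Ioo a b, u' t < 0) : StrictAntiOn u (Icc a b) := by
  refine strictAntiOn_of_hasDerivWithinAt_neg (convex_Icc a b) (f' := u')
    (hu.continuousOn.mono fun t ht => ha.trans ht.1) (fun t ht => ?_) fun t ht => ?_
  · rw [interior_Icc] at ht
    exact (hu.hasDerivAt (ha.trans_lt ht.1)).hasDerivWithinAt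
  · rw [interior_Icc] at ht
    exact hneg t ht

/-- A solution cannot reach a zero of `f` from below in finite time. -/
lemma Sol1D.map_ne_zero_of_first_critical {p : ℝ} (hp : 1 < p) {f g G u u' : ℝ → ℝ}
    (hsmp : SMP p f) (hu : Sol1D p f u u')
    (hgf : ∀ s, 0 ≤ s → g s = f s) (hG : ∀ s, HasDerivAt G (g s) s)
    {t1 : ℝ} (ht1 : 0 < t1) (hpos : ∀ t ∈ Ioo 0 t1, 0 < u' t) (hz : u' t1 = 0) :
    f (u t1) ≠ 0 := by
  intro hf
  have hp0 : 0 < p := by linarith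
  have hp1 : 0 < p - 1 := by linarith
  have hmono := hu.strictMonoOn hpos
  have hm : 0 < u t1 := by
    simpa [hu.zeroAtZero] using
      hmono (left_mem_Icc.mpr ht1.le) (right_mem_Icc.mpr ht1.le) ht1
  obtain ⟨C, hC, δ, hδ, hb⟩ := hsmp.exists_left_bound hm hf
  have hGb : ∀ s ∈ Icc δ (u t1), G (u t1) - G s ≤ C / p * (u t1 - s) ^ p := fun s hs =>
    sub_le_of_deriv_le_rpow hp hG
      (fun r hr => by rw [hgf r (hδ.1.trans hr.1.le)]; exact hb r hr) hs
  obtain ⟨t0, ht0, hut0⟩ := intermediate_value_Icc ht1.le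
    (hu.continuousOn.mono Icc_subset_Ici_self) (show δ ∈ Icc (u 0) (u t1) by
      rw [hu.zeroAtZero]; exact ⟨hδ.1, hδ.2.le⟩)
  set K : ℝ := (C / (p - 1)) ^ (1 / p)
  have hKp : K ^ p = C / (p - 1) := by
    rw [← Real.rpow_mul (by positivity), one_div_mul_cancel hp0.ne', Real.rpow_one]
  have hK : 0 ≤ K := by positivity
  have hv : 0 < u t1 - u t1 := by
    refine pos_of_deriv_ge_neg_mul (v := fun t => u t1 - u t) (v' := fun t => -u' t) (K := K) ht0.2
      (continuousOn_const.sub (hu.continuousOn.mono fun t ht => ht0.1.trans ht.1))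
      (fun t ht => (hu.hasDerivAt (ht0.1.trans_lt ht.1)).const_sub _) (fun t ht => ?_)
      (by rw [hut0]; exact sub_pos.mpr hδ.2)
    have htpos : 0 < t := ht0.1.trans_lt ht.1
    have htI : t ∈ Icc 0 t1 := ⟨htpos.le, ht.2.le⟩
    have hut : u t ∈ Icc δ (u t1) :=
      ⟨hut0 ▸ (hmono ht0 htI ht.1).le, (hmono htI (right_mem_Icc.mpr ht1.le) ht.2).le⟩
    have hE := hu.energy_eq hp hgf hG htpos.le ht1.le
    rw [hz, abs_zero, Real.zero_rpow hp0.ne', mul_zero, zero_add,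
      abs_of_pos (hpos t ⟨htpos, ht.2⟩)] at hE
    have h1 : (p - 1) / p * u' t ^ p ≤ C / p * (u t1 - u t) ^ p := by linarith [hGb _ hut]
    have h2 : u' t ^ p ≤ (K * (u t1 - u t)) ^ p := by
      rw [Real.mul_rpow hK (sub_nonneg.mpr hut.2), hKp]
      have h3 := mul_le_mul_of_nonneg_left h1 (div_pos hp0 hp1).le
      have e1 : p / (p - 1) * ((p - 1) / p * u' t ^ p) = u' t ^ p := by field_simp
      have e2 : p / (p - 1) * (C / p * (u t1 - u t) ^ p) = C / (p - 1) * (u t1 - u t) ^ p := by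
        field_simp
      rwa [e1, e2] at h3
    have h4 := (Real.rpow_le_rpow_iff (hpos t ⟨htpos, ht.2⟩).le
      (mul_nonneg hK (sub_nonneg.mpr hut.2)) hp0).mp h2
    linarith
  simp at hv

/-- At the first critical point of a solution, `f` is nonnegative and, if positive, `u'` is negative
immediately afterwards. -/
lemma Sol1D.eventually_deriv_neg {p : ℝ} {f u u' : ℝ → ℝ} (hu : Sol1D p f u u')
    {t1 : ℝ} (ht1 : 0 < t1) (hpos : ∀ t ∈ Ioo 0 t1, 0 < u' t) (hz : u' t1 = 0)
    (hf : f (u t1) ≠ 0) : ∀ᶠ t in 𝓝[>] t1, u' t < 0 := by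
  set w : ℝ → ℝ := fun s => |u' s| ^ (p - 2) * u' s
  have hw0 : w t1 = 0 := by simp [w, hz]
  have hs := hasDerivAt_iff_tendsto_slope.mp (hu.ode t1 ht1)
  have hslope : ∀ t, slope w t1 t = w t / (t - t1) := fun t => by
    rw [slope_def_field, hw0, sub_zero]
  have hle : -(f (u t1)) ≤ 0 := by
    refine le_of_tendsto (hs.mono_left (nhdsLT_le_nhdsNE t1)) ?_
    filter_upwards [Ioo_mem_nhdsLT ht1] with t ht
    rw [hslope]
    exact div_nonpos_of_nonneg_of_nonpos
      (mul_nonneg (Real.rpow_nonneg (abs_nonneg _) _) (hpos t ht).le) (by linarith [ht.2])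
  have hlt : -(f (u t1)) < 0 := lt_of_le_of_ne hle (neg_ne_zero.mpr hf)
  filter_upwards [(hs.mono_left (nhdsGT_le_nhdsNE t1)).eventually_lt_const hlt,
    self_mem_nhdsWithin] with t ht htt
  rw [hslope] at ht
  by_contra hcon
  exact absurd ht (not_lt.mpr (div_nonneg
    (mul_nonneg (Real.rpow_nonneg (abs_nonneg _) _) (not_lt.mp hcon)) (sub_nonneg.mpr htt.le)))

theorem stmt10 (p : ℝ) (hp : 1 < p) (f : ℝ → ℝ)
    (hfc : ContinuousOn f (Set.Ici 0))
    (hflip : LocLipOn f (Set.Ici 0 \ Zf f))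
    (hsmp : SMP p f)
    (u u' : ℝ → ℝ) (hu : Sol1D p f u u')
    (t1 : ℝ) (ht1 : 0 < t1)
    (hpos : ∀ t ∈ Set.Ioo 0 t1, 0 < u' t) (hz : u' t1 = 0) :
    u' 0 = 0 := by
  by_contra h0
  have hp0 : 0 < p := by linarith
  have hp1 : 0 < p - 1 := by linarith
  set g : ℝ → ℝ := fun s => f (max s 0)
  have hgc : Continuous g :=
    hfc.comp_continuous (by fun_prop) fun s => le_max_right s 0
  have hgf : ∀ s, 0 ≤ s → g s = f s := fun s hs => by simp only [g, max_eq_left hs]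
  set G : ℝ → ℝ := fun t => ∫ s in (0 : ℝ)..t, g s
  have hG : ∀ s, HasDerivAt G (g s) s := fun s => hgc.integral_hasStrictDerivAt 0 s |>.hasDerivAt
  have hGc : Continuous G := continuous_iff_continuousAt.mpr fun s => (hG s).continuousAt
  have hE : ∀ t, 0 ≤ t → (p - 1) / p * |u' t| ^ p + G (u t) = G (u t1) := by
    intro t ht
    rw [hu.energy_eq hp hgf hG ht ht1.le, hz, abs_zero, Real.zero_rpow hp0.ne', mul_zero, zero_add]
  have hGlt : ∀ s, 0 ≤ s → s < u t1 → G s < G (u t1) := by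
    intro s hs0 hsm
    obtain ⟨t, ht, rfl⟩ := intermediate_value_Icc ht1.le
      (hu.continuousOn.mono Icc_subset_Ici_self) (show s ∈ Icc (u 0) (u t1) by
        rw [hu.zeroAtZero]; exact ⟨hs0, hsm.le⟩)
    have hne : u' t ≠ 0 := by
      rcases ht.1.eq_or_lt with rfl | h
      · exact h0
      · exact (hpos t ⟨h, lt_of_le_of_ne ht.2 (by rintro rfl; exact lt_irrefl _ hsm)⟩).ne'
    have : 0 < (p - 1) / p * |u' t| ^ p :=
      mul_pos (div_pos hp1 hp0) (Real.rpow_pos_of_pos (abs_pos.mpr hne) _)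
    linarith [hE t ht.1]
  have hf := hu.map_ne_zero_of_first_critical hp hsmp hgf hG ht1 hpos hz
  obtain ⟨t2, ht2, hneg2⟩ := mem_nhdsGT_iff_exists_Ioc_subset.mp
    (hu.eventually_deriv_neg ht1 hpos hz hf)
  have ht2' : t1 < t2 := ht2
  have hneg : ∀ t, t1 < t → u' t < 0 := by
    intro t ht
    by_contra! hcon
    have ht2t : t2 ≤ t := by
      by_contra! h
      exact absurd (hneg2 ⟨ht, h.le⟩) (not_lt.mpr hcon)
    have hcont : ContinuousOn u' (Icc t2 t) :=
      hu.derivCont.mono fun s hs => (ht1.trans ht2').le.trans hs.1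
    have hcompact : IsCompact (Icc t2 t ∩ u' ⁻¹' Ici 0) :=
      isCompact_Icc.of_isClosed_subset (hcont.preimage_isClosed_of_isClosed isClosed_Icc isClosed_Ici)
        inter_subset_left
    obtain ⟨r, ⟨hr, hr0⟩, hmin⟩ := hcompact.exists_isLeast ⟨t, ⟨ht2t, le_rfl⟩, hcon⟩
    have hbefore : ∀ s ∈ Ioo t1 r, u' s < 0 := by
      intro s hs
      by_contra! h
      rcases le_or_gt s t2 with h2 | h2
      · exact absurd (hneg2 ⟨hs.1, h2⟩) (not_lt.mpr h)
      · exact absurd (hmin ⟨⟨h2.le, hs.2.le.trans hr.2⟩, h⟩) (not_le.mpr hs.2)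
    have ht1r : t1 < r := ht2'.trans_le hr.1
    have hr00 : u' r = 0 := by
      refine le_antisymm ?_ hr0
      refine le_of_tendsto ((hu.derivCont.continuousAt
        (Ici_mem_nhds (ht1.trans ht1r))).tendsto.mono_left nhdsWithin_le_nhds :
          Tendsto u' (𝓝[<] r) _) ?_
      filter_upwards [Ioo_mem_nhdsLT ht1r] with s hs using (hbefore s hs).le
    have hur := hu.strictAntiOn ht1.le hbefore (left_mem_Icc.mpr ht1r.le)
      (right_mem_Icc.mpr ht1r.le) ht1r
    have hr_nonneg : 0 ≤ r := (ht1.trans ht1r).le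
    have h1 := hE r hr_nonneg
    rw [hr00, abs_zero, Real.zero_rpow hp0.ne', mul_zero, zero_add] at h1
    exact (hGlt _ (hu.nonneg r hr_nonneg) hur).ne h1
  have hanti : StrictAntiOn u (Ici t1) := fun a ha b hb hab =>
    hu.strictAntiOn ht1.le (fun t ht => hneg t ht.1) ⟨ha, hab.le⟩ ⟨hb, le_rfl⟩ hab
  have ht20 : 0 < t2 := ht1.trans ht2'
  have hut2 : u t2 < u t1 := hanti self_mem_Ici ht2'.le ht2'
  obtain ⟨s0, hs0, hmax⟩ := isCompact_Icc.exists_isMaxOn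
    (nonempty_Icc.mpr (hu.nonneg t2 ht20.le)) (hGc.continuousOn (s := Icc 0 (u t2)))
  set μ : ℝ := p / (p - 1) * (G (u t1) - G s0)
  have hμ : 0 < μ := mul_pos (div_pos hp0 hp1)
    (sub_pos.mpr (hGlt s0 hs0.1 (hs0.2.trans_lt hut2)))
  have hc : 0 < μ ^ p⁻¹ := Real.rpow_pos_of_pos hμ _
  have hslope : ∀ t, t2 ≤ t → u' t ≤ -μ ^ p⁻¹ := by
    intro t ht
    have htnn : 0 ≤ t := ht20.le.trans ht
    have hut : u t ∈ Icc 0 (u t2) :=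
      ⟨hu.nonneg t htnn, hanti.antitoneOn ht2'.le (ht2'.le.trans ht) ht⟩
    have h1 : G (u t) ≤ G s0 := hmax hut
    have h2 : μ ≤ |u' t| ^ p := by
      have h3 : G (u t1) - G s0 ≤ (p - 1) / p * |u' t| ^ p := by linarith [hE t htnn]
      have h4 := mul_le_mul_of_nonneg_left h3 (div_pos hp0 hp1).le
      rwa [← mul_assoc, div_mul_div_cancel₀ hp1.ne', div_self hp0.ne', one_mul] at h4
    have h5 := (Real.rpow_inv_le_iff_of_pos hμ.le (abs_nonneg _) hp0).mpr h2
    rw [abs_of_neg (hneg t (ht2'.trans_le ht))] at h5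
    linarith
  set T : ℝ := t2 + (u t2 + 1) / μ ^ p⁻¹
  have hT : t2 ≤ T := le_add_of_nonneg_right
    (div_nonneg (by linarith [hu.nonneg t2 ht20.le]) hc.le)
  have hdec : u T - u t2 ≤ -μ ^ p⁻¹ * (T - t2) := by
    refine (convex_Icc t2 T).image_sub_le_mul_sub_of_deriv_le
      (hu.continuousOn.mono fun t ht => ht20.le.trans ht.1) (fun t ht => ?_) (fun t ht => ?_)
      t2 (left_mem_Icc.mpr hT) T (right_mem_Icc.mpr hT) hT
    · rw [interior_Icc] at ht
      exact (hu.hasDerivAt (ht20.trans ht.1)).differentiableAt.differentiableWithinAt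
    · rw [interior_Icc] at ht
      rw [(hu.hasDerivAt (ht20.trans ht.1)).deriv]
      exact hslope t ht.1.le
  have hmul : μ ^ p⁻¹ * (T - t2) = u t2 + 1 := by
    simp only [T, add_sub_cancel_left]
    exact mul_div_cancel₀ _ hc.ne'
  linarith [hu.nonneg T (ht20.le.trans hT)]
end

section
/- Let p > 1, let f : [0,∞) → ℝ be continuous with F(t) = ∫_0^t f(s)ds, and let ρ > 0 satisfy f(ρ) = 0, limsup_{t→ρ⁻} f(t)/(ρ−t)^{p−1} < +∞, and F(s) < F(ρ) for all s ∈ [0, ρ). Then the improper integral ∫_0^ρ (F(ρ) − F(s))^{−1/p} ds diverges to +∞. -/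
open Real Filter Set Topology MeasureTheory

/-- A finite left `limsup` of `f t / (ρ - t) ^ q` bounds `f` near `ρ` by a multiple of
`(ρ - t) ^ q`. -/
theorem exists_le_mul_rpow_of_limsup_lt_top {f : ℝ → ℝ} {q ρ : ℝ} (hρ : 0 < ρ)
    (hlim : Filter.limsup (fun t : ℝ => ((f t / (ρ - t) ^ q : ℝ) : EReal))
      (𝓝[Ico 0 ρ] ρ) < (⊤ : EReal)) :
    ∃ M > 0, ∃ δ ∈ Ico 0 ρ, ∀ t ∈ Ico δ ρ, f t ≤ M * (ρ - t) ^ q := by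
  obtain ⟨M, hM, -⟩ := EReal.lt_iff_exists_real_btwn.1 hlim
  have hev := eventually_lt_of_limsup_lt hM
  rw [nhdsWithin_Ico_eq_nhdsLT hρ] at hev
  obtain ⟨δ, hδ, hsub⟩ := mem_nhdsLT_iff_exists_Ico_subset.1 hev
  refine ⟨max M 1, by positivity, max δ 0, ⟨le_max_right _ _, max_lt hδ hρ⟩, fun t ht => ?_⟩
  have hlt : f t / (ρ - t) ^ q < M :=
    EReal.coe_lt_coe_iff.1 (hsub ⟨(le_max_left _ _).trans ht.1, ht.2⟩)
  have hpos : 0 < (ρ - t) ^ q := rpow_pos_of_pos (sub_pos.2 ht.2) _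
  exact (div_le_iff₀ hpos).1 (hlt.le.trans (le_max_left _ _))

theorem integral_sub_rpow_left {p : ℝ} (hp : 0 < p) (s ρ : ℝ) :
    ∫ t in s..ρ, (ρ - t) ^ (p - 1) = (ρ - s) ^ p / p := by
  rw [intervalIntegral.integral_comp_sub_left (fun x => x ^ (p - 1)) ρ,
    integral_rpow (Or.inl (by linarith))]
  simp [hp.ne']

theorem intervalIntegrable_of_continuousOn_Ici {f : ℝ → ℝ} (hf : ContinuousOn f (Ici 0))
    {a b : ℝ} (ha : 0 ≤ a) (hb : 0 ≤ b) : IntervalIntegrable f volume a b :=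
  (hf.mono fun _ hx => (le_min ha hb).trans hx.1).intervalIntegrable

theorem Fint_sub_le {f : ℝ → ℝ} {p ρ δ M : ℝ} (hp : 1 < p) (hf : ContinuousOn f (Ici 0))
    (hδ : δ ∈ Ico 0 ρ) (hfM : ∀ t ∈ Ico δ ρ, f t ≤ M * (ρ - t) ^ (p - 1)) {s : ℝ}
    (hs : s ∈ Ico δ ρ) : Fint f ρ - Fint f s ≤ M / p * (ρ - s) ^ p := by
  have h0s : 0 ≤ s := hδ.1.trans hs.1
  have h0ρ : 0 ≤ ρ := h0s.trans hs.2.le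
  have hcont : Continuous fun t : ℝ => M * (ρ - t) ^ (p - 1) :=
    continuous_const.mul ((continuous_const.sub continuous_id).rpow_const
      fun _ => Or.inr (by linarith))
  calc Fint f ρ - Fint f s = ∫ t in s..ρ, f t :=
        intervalIntegral.integral_interval_sub_left
          (intervalIntegrable_of_continuousOn_Ici hf le_rfl h0ρ)
          (intervalIntegrable_of_continuousOn_Ici hf le_rfl h0s)
    _ ≤ ∫ t in s..ρ, M * (ρ - t) ^ (p - 1) :=
        intervalIntegral.integral_mono_on_of_le_Ioo hs.2.le
          (intervalIntegrable_of_continuousOn_Ici hf h0s h0ρ) (hcont.intervalIntegrable _ _)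
          fun t ht => hfM t ⟨hs.1.trans ht.1.le, ht.2⟩
    _ = M / p * (ρ - s) ^ p := by
        rw [intervalIntegral.integral_const_mul, integral_sub_rpow_left (by linarith)]
        ring

theorem continuousOn_Fint {f : ℝ → ℝ} (hf : ContinuousOn f (Ici 0)) (b : ℝ) (hb : 0 ≤ b) :
    ContinuousOn (Fint f) (Icc 0 b) := by
  have h := intervalIntegral.continuousOn_primitive_interval (μ := volume) (f := f)
    (a := 0) (b := b)
    ((hf.mono (by rw [uIcc_of_le hb]; exact fun _ hx => hx.1)).integrableOn_compact
      isCompact_uIcc)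
  rwa [uIcc_of_le hb] at h

theorem integral_inv_sub_left {δ t ρ : ℝ} (hδt : δ ≤ t) (ht : t < ρ) :
    ∫ s in δ..t, (ρ - s)⁻¹ = log (ρ - δ) - log (ρ - t) := by
  rw [intervalIntegral.integral_comp_sub_left (fun x => x⁻¹) ρ,
    integral_inv_of_pos (by linarith) (by linarith), log_div (by linarith) (by linarith)]

theorem rpow_neg_inv_ge {c x g p : ℝ} (hp : 0 < p) (hc : 0 < c) (hx : 0 < x) (hg : 0 < g)
    (h : g ≤ c * x ^ p) : c ^ (-(1 / p)) * x⁻¹ ≤ g ^ (-(1 / p)) := by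
  have hx' : (x ^ p) ^ (-(1 / p)) = x⁻¹ := by
    rw [← rpow_mul hx.le, ← rpow_neg_one]
    congr 1
    field_simp
  rw [← hx', ← mul_rpow hc.le (by positivity)]
  exact rpow_le_rpow_of_nonpos hg h (by simpa using hp.le)

theorem tendsto_neg_log_sub_left (ρ : ℝ) :
    Tendsto (fun t => -log (ρ - t)) (𝓝[<] ρ) atTop := by
  refine tendsto_neg_atBot_atTop.comp (tendsto_log_nhdsGT_zero.comp ?_)
  refine tendsto_nhdsWithin_iff.2 ⟨?_, ?_⟩
  · have : Tendsto (fun t => ρ - t) (𝓝 ρ) (𝓝 (ρ - ρ)) :=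
      (continuous_const.sub continuous_id).tendsto ρ
    rw [sub_self] at this
    exact this.mono_left nhdsWithin_le_nhds
  · filter_upwards [self_mem_nhdsWithin] with t ht
    exact sub_pos.2 (mem_Iio.1 ht)

theorem stmt11 (p : ℝ) (hp : 1 < p) (f : ℝ → ℝ)
    (hfc : ContinuousOn f (Set.Ici 0))
    (ρ : ℝ) (hρ : 0 < ρ) (hfρ : f ρ = 0)
    (hlim : Filter.limsup (fun t : ℝ => ((f t / (ρ - t) ^ (p - 1) : ℝ) : EReal))
      (nhdsWithin ρ (Set.Ico 0 ρ)) < (⊤ : EReal))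
    (hF : ∀ s ∈ Set.Ico 0 ρ, Fint f s < Fint f ρ) :
    Filter.Tendsto (fun t : ℝ => ∫ s in (0:ℝ)..t, (Fint f ρ - Fint f s) ^ (-(1/p)))
      (nhdsWithin ρ (Set.Iio ρ)) Filter.atTop := by
  obtain ⟨M, hM, δ, hδ, hfM⟩ := exists_le_mul_rpow_of_limsup_lt_top hρ hlim
  have hp0 : 0 < p := by linarith
  set c := (M / p) ^ (-(1 / p))
  have hc0 : 0 < c := rpow_pos_of_pos (by positivity) _
  set g : ℝ → ℝ := fun s => (Fint f ρ - Fint f s) ^ (-(1 / p))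
  have hgc : ContinuousOn g (Ico 0 ρ) :=
    (continuousOn_const.sub ((continuousOn_Fint hfc ρ hρ.le).mono Ico_subset_Icc_self)).rpow_const
      fun s hs => Or.inl (sub_pos.2 (hF s hs)).ne'
  have hgi : ∀ a b, a ∈ Ico 0 ρ → b ∈ Ico 0 ρ → IntervalIntegrable g volume a b :=
    fun a b ha hb => (hgc.mono (ordConnected_Ico.uIcc_subset ha hb)).intervalIntegrable
  have hlower : Tendsto (fun t => (∫ s in (0:ℝ)..δ, g s) + c * (log (ρ - δ) + -log (ρ - t)))
      (𝓝[<] ρ) atTop :=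
    tendsto_atTop_add_const_left _ _ ((tendsto_atTop_add_const_left _ _
      (tendsto_neg_log_sub_left ρ)).const_mul_atTop hc0)
  refine tendsto_atTop_mono' _ ?_ hlower
  filter_upwards [Ico_mem_nhdsLT hδ.2] with t ht
  have ht0 : t ∈ Ico 0 ρ := ⟨hδ.1.trans ht.1, ht.2⟩
  rw [← intervalIntegral.integral_add_adjacent_intervals (hgi 0 δ ⟨le_rfl, hρ⟩ hδ) (hgi δ t hδ ht0),
    ← sub_eq_add_neg, ← integral_inv_sub_left ht.1 ht.2, ← intervalIntegral.integral_const_mul]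
  gcongr
  refine intervalIntegral.integral_mono_on ht.1 ?_ (hgi δ t hδ ht0) fun s hs => ?_
  · refine ContinuousOn.intervalIntegrable (continuousOn_const.mul
      ((continuousOn_const.sub continuousOn_id).inv₀ fun s hs => ?_))
    rw [uIcc_of_le ht.1] at hs
    exact (sub_pos.2 (hs.2.trans_lt ht.2)).ne'
  · have hsρ : s < ρ := hs.2.trans_lt ht.2
    exact rpow_neg_inv_ge hp0 (by positivity) (sub_pos.2 hsρ)
      (sub_pos.2 (hF s ⟨hδ.1.trans hs.1, hsρ⟩)) (Fint_sub_le hp hfc hδ hfM ⟨hs.1, hsρ⟩)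
end

section
/- Let p > 1, let f : [0,∞) → ℝ be continuous with F(t) = ∫_0^t f(s)ds, and let ρ ∈ Z_f^*. Then for every t ∈ (0, ρ), the improper integral ∫_0^t (F(ρ) − F(s))^{−1/p} ds is finite. -/
open Real Filter Set Topology MeasureTheory

/-- The set `Z_f^* = {z ∈ Z_f : F(t) < F(z) for all t ∈ [0,z)} ∪ Z_f^0`, where
`Z_f^0 = {z ∈ Z_f : F(t) < 0 = F(z) for all t ∈ (0,z)}` if `f(0) < 0` and `∅` otherwise. -/
def Zfstar (f : ℝ → ℝ) : Set ℝ :=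
  {z ∈ Zf f | ∀ t ∈ Set.Ico 0 z, Fint f t < Fint f z} ∪
  {z ∈ Zf f | f 0 < 0 ∧ Fint f z = 0 ∧ ∀ t ∈ Set.Ioo 0 z, Fint f t < 0}

lemma Fint_continuousOn {f : ℝ → ℝ} (hfc : ContinuousOn f (Set.Ici 0)) {t : ℝ} (ht : 0 ≤ t) :
    ContinuousOn (Fint f) (Set.Icc 0 t) := by
  have h := intervalIntegral.continuousOn_primitive_interval (f := f) (μ := volume) (a := 0) (b := t)
    (by
      rw [Set.uIcc_of_le ht]
      exact (hfc.mono Set.Icc_subset_Ici_self).integrableOn_Icc)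
  rwa [Set.uIcc_of_le ht] at h

lemma intervalIntegrable_sub_Fint_rpow {f : ℝ → ℝ} (hfc : ContinuousOn f (Set.Ici 0))
    {a t M q : ℝ} (ha : 0 ≤ a) (hat : a ≤ t) (h : ∀ s ∈ Set.Icc a t, Fint f s < M) :
    IntervalIntegrable (fun s : ℝ => (M - Fint f s) ^ q) volume a t := by
  apply ContinuousOn.intervalIntegrable
  rw [Set.uIcc_of_le hat]
  exact (continuousOn_const.sub ((Fint_continuousOn hfc (ha.trans hat)).mono
    (Set.Icc_subset_Icc_left ha))).rpow_const fun s hs => Or.inl (sub_pos.2 (h s hs)).ne'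

lemma exists_Fint_le_neg_mul {f : ℝ → ℝ} (hfc : ContinuousOn f (Set.Ici 0)) (hf0 : f 0 < 0) :
    ∃ c > 0, ∃ δ > 0, ∀ s ∈ Set.Icc 0 δ, Fint f s ≤ -(c * s) := by
  have hev : ∀ᶠ x in 𝓝[≥] (0 : ℝ), f x < f 0 / 2 :=
    (hfc 0 Set.self_mem_Ici).eventually_lt_const (by linarith)
  obtain ⟨δ, hδ, hsub⟩ := mem_nhdsGE_iff_exists_Icc_subset.1 hev
  refine ⟨-(f 0 / 2), by linarith, δ, hδ, fun s hs => ?_⟩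
  have hint : IntervalIntegrable f volume 0 s := by
    apply ContinuousOn.intervalIntegrable
    rw [Set.uIcc_of_le hs.1]
    exact hfc.mono Set.Icc_subset_Ici_self
  have h := intervalIntegral.integral_mono_on hs.1 hint
    (intervalIntegrable_const (c := f 0 / 2)) fun x hx => (hsub ⟨hx.1, hx.2.trans hs.2⟩ : _ < _).le
  rw [intervalIntegral.integral_const, smul_eq_mul] at h
  unfold Fint
  linarith


theorem stmt12 (p : ℝ) (hp : 1 < p) (f : ℝ → ℝ)
    (hfc : ContinuousOn f (Set.Ici 0))
    (ρ : ℝ) (hρ : ρ ∈ Zfstar f) :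
    ∀ t ∈ Set.Ioo 0 ρ,
      IntervalIntegrable (fun s : ℝ => (Fint f ρ - Fint f s) ^ (-(1/p)))
        MeasureTheory.volume 0 t := by
  rintro t ⟨ht0, htρ⟩
  rcases hρ with ⟨-, h⟩ | ⟨-, hf0, hF, h⟩
  · exact intervalIntegrable_sub_Fint_rpow hfc le_rfl ht0.le
      fun s hs => h s ⟨hs.1, hs.2.trans_lt htρ⟩
  obtain ⟨c, hc, δ, hδ, hle⟩ := exists_Fint_le_neg_mul hfc hf0
  have hm : 0 < min δ t := lt_min hδ ht0
  have hp' : 1 / p < 1 := (div_lt_one (by linarith)).2 hp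
  have hp0 : 0 < 1 / p := by positivity
  refine IntervalIntegrable.trans (b := min δ t) ?_
    (intervalIntegrable_sub_Fint_rpow hfc hm.le (min_le_right _ _) fun s hs => ?_)
  · have hdom : IntervalIntegrable (fun s : ℝ => c ^ (-(1 / p)) * s ^ (-(1 / p))) volume 0
        (min δ t) :=
      (intervalIntegral.intervalIntegrable_rpow' (by linarith)).const_mul _
    refine hdom.mono_fun ?_ ?_
    · rw [Set.uIoc_of_le hm.le]
      refine ContinuousOn.aestronglyMeasurable (fun s hs => ?_) measurableSet_Ioc
      have hs' : s ∈ Set.Icc 0 (min δ t) := Set.Ioc_subset_Icc_self hs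
      refine ((continuousOn_const.sub (Fint_continuousOn hfc hm.le)) s hs').mono
        Set.Ioc_subset_Icc_self |>.rpow_const (Or.inl ?_)
      have := hle s ⟨hs.1.le, hs.2.trans (min_le_left _ _)⟩
      have := mul_pos hc hs.1
      exact (show 0 < Fint f ρ - Fint f s by linarith).ne'
    · rw [Set.uIoc_of_le hm.le]
      filter_upwards [ae_restrict_mem measurableSet_Ioc] with s hs
      have h1 := hle s ⟨hs.1.le, hs.2.trans (min_le_left _ _)⟩
      have h2 := mul_pos hc hs.1
      rw [← Real.mul_rpow hc.le hs.1.le, Real.norm_of_nonneg (Real.rpow_nonneg (by linarith) _),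
        Real.norm_of_nonneg (Real.rpow_nonneg h2.le _)]
      exact Real.rpow_le_rpow_of_nonpos h2 (by linarith) (by linarith)
  · rw [hF]
    exact h s ⟨hm.trans_le hs.1, hs.2.trans_lt htρ⟩
end

section
/- Let p > 1, let f : [0,∞) → ℝ be continuous with f(0) < 0, let F(t) = ∫_0^t f(s)ds, and let ρ ∈ P_f. Then the improper integral ∫_0^ρ (F(ρ) − F(s))^{−1/p} ds is finite. -/
open Real Filter Set Topology MeasureTheory

/-- The set `P_f = {z > 0 : F(t) < 0 = F(z) for all t ∈ (0,z) and f(z) > 0}`. -/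
def Pf (f : ℝ → ℝ) : Set ℝ :=
  {z : ℝ | 0 < z ∧ 0 < f z ∧ Fint f z = 0 ∧ ∀ t ∈ Set.Ioo 0 z, Fint f t < 0}

/-- A negative power with exponent above `-1` of a function that leaves zero with positive slope
and stays positive is integrable. -/
theorem intervalIntegrable_rpow_of_hasDerivAt_pos {g : ℝ → ℝ} {c d r : ℝ} (hr : -1 < r)
    (hr0 : r ≤ 0) (hd : 0 < d) (hg : Continuous g) (hg0 : g 0 = 0) (hc : 0 < c)
    (hderiv : HasDerivAt g c 0) (hpos : ∀ s ∈ Set.Ioc 0 d, 0 < g s) :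
    IntervalIntegrable (fun s => g s ^ r) volume 0 d := by
  have hev : ∀ᶠ s in 𝓝[>] (0 : ℝ), c / 2 * s ≤ g s := by
    have h := hderiv.tendsto_slope_zero_right
    filter_upwards [h.eventually (lt_mem_nhds (half_lt_self hc)), self_mem_nhdsWithin] with s hs hs0
    have hs0 : 0 < s := hs0
    simp only [zero_add, hg0, sub_zero, smul_eq_mul] at hs
    rw [inv_mul_eq_div, lt_div_iff₀ hs0] at hs
    exact hs.le
  obtain ⟨e, he, hev⟩ := mem_nhdsGT_iff_exists_Ioc_subset.1 hev
  have he : 0 < e := he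
  obtain ⟨δ, hδ0, hδe, hδd⟩ : ∃ δ, 0 < δ ∧ δ ≤ e ∧ δ ≤ d :=
    ⟨min e d, lt_min he hd, min_le_left _ _, min_le_right _ _⟩
  have hcont : ContinuousOn (fun s => g s ^ r) (Set.Ioc 0 d) :=
    hg.continuousOn.rpow_const fun s hs => Or.inl (hpos s hs).ne'
  refine IntervalIntegrable.trans (b := δ) ?_ (ContinuousOn.intervalIntegrable ?_)
  · refine ((intervalIntegral.intervalIntegrable_rpow' hr (a := 0) (b := δ)).const_mul
      ((c / 2) ^ r)).mono_fun ?_ ?_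
    · rw [Set.uIoc_of_le hδ0.le]
      exact (hcont.mono (Set.Ioc_subset_Ioc_right hδd)).aestronglyMeasurable measurableSet_Ioc
    · rw [Set.uIoc_of_le hδ0.le]
      refine (ae_restrict_mem measurableSet_Ioc).mono fun s hs => ?_
      have hgs := hpos s ⟨hs.1, hs.2.trans hδd⟩
      have hs0 : 0 < s := hs.1
      have hle : c / 2 * s ≤ g s := hev ⟨hs.1, hs.2.trans hδe⟩
      beta_reduce
      rw [← Real.mul_rpow (by positivity) hs0.le, Real.norm_of_nonneg (by positivity),
        Real.norm_of_nonneg (by positivity)]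
      exact Real.rpow_le_rpow_of_nonpos (by positivity) hle hr0
  · rw [Set.uIcc_of_le hδd]
    exact hcont.mono fun s hs => ⟨hδ0.trans_le hs.1, hs.2⟩

theorem stmt13 (p : ℝ) (hp : 1 < p) (f : ℝ → ℝ)
    (hfc : ContinuousOn f (Set.Ici 0))
    (hf0 : f 0 < 0) (ρ : ℝ) (hρ : ρ ∈ Pf f) :
    IntervalIntegrable (fun s : ℝ => (Fint f ρ - Fint f s) ^ (-(1/p)))
      MeasureTheory.volume 0 ρ := by
  obtain ⟨hρ0, hfρ, hFρ, hneg⟩ := hρ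
  have hp1 : 1 / p < 1 := (div_lt_one (by linarith)).2 hp
  have hp0 : 0 < 1 / p := by positivity
  -- Extend `f` to the left of `0` by its value there, so that the primitive is `C¹` on `ℝ`.
  set h : ℝ → ℝ := fun t => f (max t 0) with hh
  have hcont : Continuous h :=
    hfc.comp_continuous (by fun_prop) fun t => le_max_right t 0
  have hF : ∀ t, 0 ≤ t → Fint h t = Fint f t := fun t ht => by
    refine intervalIntegral.integral_congr fun s hs => ?_
    rw [Set.uIcc_of_le ht] at hs
    simp only [hh, max_eq_left hs.1]
  have hder : ∀ t, HasDerivAt (Fint h) (h t) t := fun t =>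
    intervalIntegral.integral_hasDerivAt_right (hcont.intervalIntegrable _ _)
      (hcont.stronglyMeasurableAtFilter _ _) hcont.continuousAt
  have hFc : Continuous (Fint h) :=
    continuous_iff_continuousAt.2 fun t => (hder t).continuousAt
  have hpos : ∀ s ∈ Set.Ioo 0 ρ, 0 < -Fint h s := fun s hs => by
    rw [hF s hs.1.le]
    exact neg_pos.2 (hneg s hs)
  have hleft : IntervalIntegrable (fun s => (-Fint h s) ^ (-(1 / p))) volume 0 (ρ / 2) :=
    intervalIntegrable_rpow_of_hasDerivAt_pos (c := -h 0) (by linarith) (by linarith)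
      (by linarith) hFc.neg (by simp [Fint]) (by simpa [hh] using hf0) (hder 0).neg
      fun s hs => hpos s ⟨hs.1, by linarith [hs.2]⟩
  have hright : IntervalIntegrable (fun s => (-Fint h (ρ - s)) ^ (-(1 / p))) volume 0 (ρ / 2) := by
    refine intervalIntegrable_rpow_of_hasDerivAt_pos (c := h ρ) (by linarith) (by linarith)
      (by linarith) (by fun_prop) (by simp [hF ρ hρ0.le, hFρ])
      (by simpa [hh, max_eq_left hρ0.le] using hfρ) ?_
      fun s hs => hpos _ ⟨by linarith [hs.2], by linarith [hs.1]⟩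
    simpa using ((hder (ρ - 0)).comp_const_sub ρ 0).fun_neg
  have hright' := (hright.comp_sub_left ρ).symm
  simp only [sub_sub_cancel, sub_zero, sub_half] at hright'
  refine (hleft.trans hright').congr fun s hs => ?_
  rw [Set.uIoc_of_le hρ0.le] at hs
  simp only [hFρ, hF s hs.1.le, zero_sub]
end
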